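/- arXiv:2108.08987 — 6 statements merged into one kernel-verified Lean document; each statement's English description precedes it below -/
import Mathlib

section
/- Fix ε > 0, δ ∈ (0,1], and a positive integer Δ. Let λ be a real number with λ ≥ 16·log(2/δ)/(1−e^{−ε/Δ})² + 2Δ/(1−e^{−ε/Δ}), and let η be a Poisson(λ) random variable. Then for all integers m, m' with |m − m'| ≤ Δ and every set S ⊆ ℤ, one has P(m + η ∈ S) ≤ e^ε · P(m' + η ∈ S) + δ. -/
open MeasureTheory ProbabilityTheory NNReal ENNReal Real

/-- If `f` maps `A` injectively into `B` and `μ {a} ≤ c * ν {f a}` for all `a ∈ A`,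
then `μ A ≤ c * ν B`. -/
lemma measure_le_mul_of_forall_singleton_le {α β : Type*} [Countable α]
    [MeasurableSpace α] [MeasurableSpace β] [DiscreteMeasurableSpace α]
    [DiscreteMeasurableSpace β] {μ : Measure α} {ν : Measure β} {A : Set α} {B : Set β}
    {f : α → β} {c : ℝ≥0∞} (hf : Set.MapsTo f A B) (hinj : Set.InjOn f A)
    (h : ∀ a ∈ A, μ {a} ≤ c * ν {f a}) : μ A ≤ c * ν B := by
  calc μ A ≤ c * ν (f '' A) := ?_
    _ ≤ c * ν B := by gcongr; exact hf.image_subset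
  have himage : ν (f '' A) = ∑' a : A, ν {f a} := by
    rw [← Set.biUnion_of_singleton (f '' A), Set.biUnion_image]
    exact measure_biUnion A.to_countable
      (fun x hx y hy hxy => Set.disjoint_singleton.2 (hinj.ne hx hy hxy))
      (fun x _ => MeasurableSet.of_discrete)
  have hA : μ A = ∑' a : A, μ {(a : α)} := by
    rw [← measure_biUnion A.to_countable
      (fun x _ y _ hxy => Set.disjoint_singleton.2 hxy)
      (fun x _ => MeasurableSet.of_discrete), Set.biUnion_of_singleton]
  rw [hA, himage, ← ENNReal.tsum_mul_left]
  exact ENNReal.tsum_le_tsum fun a => h a a.2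

/-- A Chernoff bound for both tails of the Poisson distribution, according to the sign of `s`. -/
lemma poissonMeasure_le_exp_neg (r : ℝ≥0) {s : ℝ} (hs : |s| ≤ 1) {B : Set ℕ}
    (hB : ∀ n ∈ B, s * r + 2 * r * s ^ 2 ≤ s * n) :
    poissonMeasure r B ≤ ENNReal.ofReal (exp (-(r * s ^ 2))) := by
  have htilt : poissonMeasure r B ≤
      ENNReal.ofReal (exp (-(r * s ^ 2))) * poissonMeasure (r * (exp s).toNNReal) B := by
    refine measure_le_mul_of_forall_singleton_le (f := id) (Set.mapsTo_id B)
      (Set.injOn_id B) fun n hn => ?_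
    rw [id, poissonMeasure_singleton, poissonMeasure_singleton,
      ← ENNReal.ofReal_mul (exp_pos _).le]
    apply ENNReal.ofReal_le_ofReal
    have hexp : exp s ≤ 1 + s + s ^ 2 := by
      linarith [(abs_le.1 (abs_exp_sub_one_sub_id_le hs)).2]
    have hr : (r : ℝ) * exp s ≤ r * (1 + s + s ^ 2) :=
      mul_le_mul_of_nonneg_left hexp r.coe_nonneg
    rw [NNReal.coe_mul, coe_toNNReal _ (exp_pos s).le, mul_pow, ← exp_nat_mul]
    calc exp (-r) * (r : ℝ) ^ n / n.factorial
        ≤ exp (-(r * s ^ 2) + -(r * exp s) + n * s) * (r : ℝ) ^ n / n.factorial := by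
          gcongr
          linarith [hB n hn]
      _ = _ := by rw [exp_add, exp_add]; ring
  exact htilt.trans (mul_le_of_le_one_right' prob_le_one)

lemma poissonMeasure_singleton_le_mul_add (r : ℝ≥0) {a : ℝ} {n d : ℕ}
    (h : (n + d : ℝ) ≤ r * exp a) :
    poissonMeasure r {n} ≤ ENNReal.ofReal (exp (d * a)) * poissonMeasure r {n + d} := by
  rw [poissonMeasure_singleton, poissonMeasure_singleton, ← ENNReal.ofReal_mul (exp_pos _).le]
  apply ENNReal.ofReal_le_ofReal
  have hfact : ((n + d).factorial : ℝ) ≤ n.factorial * (r ^ d * exp (d * a)) := by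
    rw [exp_nat_mul, ← mul_pow]
    calc ((n + d).factorial : ℝ) ≤ n.factorial * (n + d : ℝ) ^ d := by
          rw [← Nat.factorial_mul_ascFactorial]
          exact_mod_cast Nat.mul_le_mul_left _ (Nat.ascFactorial_le_pow_add n d)
      _ ≤ _ := by gcongr
  rw [← mul_div_assoc, div_le_div_iff₀ (by positivity) (by positivity)]
  calc exp (-r) * (r : ℝ) ^ n * (n + d).factorial
      ≤ exp (-r) * (r : ℝ) ^ n * (n.factorial * (r ^ d * exp (d * a))) := by gcongr
    _ = _ := by ring

lemma poissonMeasure_singleton_add_le_mul (r : ℝ≥0) {a : ℝ} {n d : ℕ}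
    (h : (r : ℝ) ≤ (n + 1) * exp a) :
    poissonMeasure r {n + d} ≤ ENNReal.ofReal (exp (d * a)) * poissonMeasure r {n} := by
  rw [poissonMeasure_singleton, poissonMeasure_singleton, ← ENNReal.ofReal_mul (exp_pos _).le]
  apply ENNReal.ofReal_le_ofReal
  have hfact : (r : ℝ) ^ d * n.factorial ≤ (n + d).factorial * exp (d * a) := by
    calc (r : ℝ) ^ d * n.factorial ≤ ((n + 1) * exp a) ^ d * n.factorial := by gcongr
      _ = (n.factorial * (n + 1) ^ d) * exp (d * a) := by rw [mul_pow, exp_nat_mul]; ring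
      _ ≤ _ := by
          gcongr
          exact_mod_cast Nat.factorial_mul_pow_le_factorial
  rw [← mul_div_assoc, div_le_div_iff₀ (by positivity) (by positivity)]
  calc exp (-r) * (r : ℝ) ^ (n + d) * n.factorial
      = exp (-r) * (r : ℝ) ^ n * (r ^ d * n.factorial) := by ring
    _ ≤ exp (-r) * (r : ℝ) ^ n * ((n + d).factorial * exp (d * a)) := by gcongr
    _ = _ := by ring

/-- The Poisson mechanism: if `η` is Poisson(`lam`) with
`lam ≥ 16 log(2/δ)/(1−e^{−ε/Δ})² + 2Δ/(1−e^{−ε/Δ})`, then for all integers `m, m'`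
with `|m − m'| ≤ Δ` and every `S ⊆ ℤ`,
`P(m + η ∈ S) ≤ e^ε · P(m' + η ∈ S) + δ`. -/
theorem poisson_mechanism {Ω : Type*} [MeasurableSpace Ω]
    (P : Measure Ω) [IsProbabilityMeasure P]
    (ε δ : ℝ) (hε : 0 < ε) (hδ0 : 0 < δ) (hδ1 : δ ≤ 1)
    (Δ : ℕ) (hΔ : 0 < Δ) (lam : ℝ≥0)
    (hlam : (lam : ℝ) ≥
      16 * Real.log (2 / δ) / (1 - Real.exp (-ε / Δ)) ^ 2 +
        2 * Δ / (1 - Real.exp (-ε / Δ)))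
    (η : Ω → ℕ) (hη : Measurable η)
    (hlaw : Measure.map η P = poissonMeasure lam) :
    ∀ (m m' : ℤ), |m - m'| ≤ (Δ : ℤ) → ∀ S : Set ℤ,
      P {ω | m + (η ω : ℤ) ∈ S} ≤
        ENNReal.ofReal (Real.exp ε) * P {ω | m' + (η ω : ℤ) ∈ S} +
          ENNReal.ofReal δ := by
  intro m m' hm S
  have hlaw' (k : ℤ) : P {ω | k + (η ω : ℤ) ∈ S} =
      poissonMeasure lam {n : ℕ | k + (n : ℤ) ∈ S} := by
    rw [← hlaw, Measure.map_apply hη MeasurableSet.of_discrete]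
    rfl
  rw [hlaw', hlaw']
  have hΔ' : (0 : ℝ) < Δ := by exact_mod_cast hΔ
  obtain ⟨a, ha⟩ : ∃ a, a = ε / Δ := ⟨_, rfl⟩
  have ha0 : 0 < a := ha ▸ div_pos hε hΔ'
  have haΔ : Δ * a = ε := by rw [ha]; field_simp
  rw [neg_div, ← ha] at hlam
  obtain ⟨c, hc⟩ : ∃ c, c = 1 - exp (-a) := ⟨_, rfl⟩
  rw [← hc] at hlam
  have hc0 : 0 < c := by rw [hc, sub_pos, exp_lt_one_iff]; linarith
  have hc1 : c < 1 := by rw [hc]; linarith [exp_pos (-a)]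
  have hlog : 0 ≤ Real.log (2 / δ) := log_nonneg (by rw [le_div_iff₀ hδ0]; linarith)
  have hlamΔ : 2 * (Δ : ℝ) ≤ lam * c := by
    rw [← div_le_iff₀ hc0]
    have : 0 ≤ 16 * Real.log (2 / δ) / c ^ 2 := by positivity
    linarith
  have hlamlog : 16 * Real.log (2 / δ) ≤ lam * c ^ 2 := by
    rw [← div_le_iff₀ (by positivity)]
    have : 0 ≤ 2 * (Δ : ℝ) / c := by positivity
    linarith
  have hlam0 : 0 < (lam : ℝ) := pos_of_mul_pos_left (by linarith) hc0.le
  have hexpδ : exp (-(lam * (c / 4) ^ 2)) ≤ δ := by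
    calc exp (-(lam * (c / 4) ^ 2)) ≤ exp (-Real.log (2 / δ)) := by gcongr; linarith
      _ = δ / 2 := by rw [exp_neg, exp_log (by positivity), inv_div]
      _ ≤ δ := by linarith
  have hsplit (A A' G : Set ℕ) (hG : poissonMeasure lam (A ∩ G) ≤
        ENNReal.ofReal (exp ε) * poissonMeasure lam A')
      (hGc : poissonMeasure lam Gᶜ ≤ ENNReal.ofReal δ) :
      poissonMeasure lam A ≤
        ENNReal.ofReal (exp ε) * poissonMeasure lam A' + ENNReal.ofReal δ := by
    refine (measure_le_inter_add_sdiff _ A G).trans (add_le_add hG ((measure_mono ?_).trans hGc))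
    exact fun n hn => hn.2
  have hmul {d : ℕ} (hd : d ≤ Δ) : d * a ≤ ε := by rw [← haΔ]; gcongr
  rcases le_total m' m with h | h
  · obtain ⟨d, hd⟩ := Int.eq_ofNat_of_zero_le (sub_nonneg.2 h)
    have hdΔ : d ≤ Δ := by have := (abs_le.1 hm).2; omega
    have hdΔ' : (d : ℝ) ≤ Δ := by exact_mod_cast hdΔ
    refine hsplit _ _ {n | (n + d : ℝ) ≤ lam * exp a} ?_ ?_
    · refine measure_le_mul_of_forall_singleton_le (f := (· + d)) ?_
        (add_left_injective d).injOn fun n hn => ?_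
      · rintro n ⟨hn, -⟩
        simp only [Set.mem_ofPred_eq] at hn ⊢
        convert hn using 1
        push_cast
        omega
      · refine (poissonMeasure_singleton_le_mul_add lam hn.2).trans ?_
        gcongr
        exact hmul hdΔ
    · refine (poissonMeasure_le_exp_neg lam (s := c / 4) ?_ ?_).trans
        (ENNReal.ofReal_le_ofReal hexpδ)
      · rw [abs_of_pos (by positivity)]; linarith
      · intro n hn
        have hn' : lam * exp a < n + d := by simpa using hn
        have hexp : 1 + c ≤ exp a := by
          have : exp a * (1 - c) = 1 := by rw [hc, _root_.sub_sub_cancel, ← exp_add]; simp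
          nlinarith
        have hlow : lam * (1 + c) ≤ lam * exp a := by gcongr
        nlinarith
  · obtain ⟨d, hd⟩ := Int.eq_ofNat_of_zero_le (sub_nonneg.2 h)
    have hdΔ : d ≤ Δ := by have := (abs_le.1 hm).1; omega
    have hdΔ' : (d : ℝ) ≤ Δ := by exact_mod_cast hdΔ
    have hle {n : ℕ} (hn : (lam : ℝ) * exp (-a) ≤ n - d + 1) : d ≤ n := by
      have : (d : ℝ) < n + 1 := by
        have := mul_pos hlam0 (exp_pos (-a))
        linarith
      exact Nat.lt_succ_iff.1 (by exact_mod_cast this)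
    refine hsplit _ _ {n | (lam : ℝ) * exp (-a) ≤ n - d + 1} ?_ ?_
    · refine measure_le_mul_of_forall_singleton_le (f := (· - d)) ?_ ?_ fun n hn => ?_
      · rintro n ⟨hn, hnG⟩
        have := hle hnG
        simp only [Set.mem_ofPred_eq] at hn ⊢
        convert hn using 1
        omega
      · rintro n ⟨-, hn⟩ k ⟨-, hk⟩ hnk
        have := hle hn
        have := hle hk
        simp only at hnk
        omega
      · obtain ⟨k, rfl⟩ := Nat.exists_eq_add_of_le' (hle hn.2)
        have hk : (lam : ℝ) ≤ (k + 1) * exp a := by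
          have hkG : (lam : ℝ) * exp (-a) ≤ k + 1 := by simpa using hn.2
          rwa [exp_neg, ← div_eq_mul_inv, div_le_iff₀ (exp_pos a)] at hkG
        simp only [Nat.add_sub_cancel]
        refine (poissonMeasure_singleton_add_le_mul lam hk).trans ?_
        gcongr
        exact hmul hdΔ
    · refine (poissonMeasure_le_exp_neg lam (s := -(c / 4)) ?_ ?_).trans
        (ENNReal.ofReal_le_ofReal (by rwa [neg_sq]))
      · rw [abs_neg, abs_of_pos (by positivity)]; linarith
      · intro n hn
        have hn' : (n : ℝ) - d + 1 < lam * (1 - c) := by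
          rw [hc, _root_.sub_sub_cancel]; simpa using hn
        nlinarith
end

section
/- Let a ≥ 0 and μ ∈ ℝ, and let M be a Poisson(a) random variable. Then Var[(M − μ)² − M] = 2a² + 4a(a − μ)². In particular, if a = μ then E[((M − μ)² − M)²] = 2μ². -/
open MeasureTheory ProbabilityTheory NNReal

/-- The `k`-th factorial moment of the Poisson distribution. -/
theorem hasSum_poisson_mul_descFactorial (a : ℝ≥0) (k : ℕ) :
    HasSum (fun n : ℕ => Real.exp (-a) * (a : ℝ) ^ n / n.factorial * (n.descFactorial k : ℝ))
      ((a : ℝ) ^ k) := by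
  rw [← hasSum_nat_add_iff' k]
  have hzero : ∑ n ∈ Finset.range k,
      Real.exp (-a) * (a : ℝ) ^ n / n.factorial * (n.descFactorial k : ℝ) = 0 :=
    Finset.sum_eq_zero fun n hn => by
      simp [Nat.descFactorial_of_lt (Finset.mem_range.mp hn)]
  rw [hzero, sub_zero]
  have h := (hasSum_one_poissonMeasure a).mul_left ((a : ℝ) ^ k)
  rw [mul_one] at h
  refine h.congr_fun fun n => ?_
  have hfac : ((n + k).factorial : ℝ) = n.factorial * (n + k).descFactorial k := by
    have := Nat.factorial_mul_descFactorial (Nat.le_add_left k n)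
    rw [Nat.add_sub_cancel] at this
    exact_mod_cast this.symm
  have hdesc : ((n + k).descFactorial k : ℝ) ≠ 0 := by
    simp [Nat.descFactorial_eq_zero_iff_lt]
  rw [hfac]
  field_simp
  ring

theorem integral_poissonMeasure_eq_of_hasSum {a : ℝ≥0} {f : ℕ → ℝ} {s : ℝ}
    (h : HasSum (fun n : ℕ => Real.exp (-a) * (a : ℝ) ^ n / n.factorial * f n) s) :
    ∫ n, f n ∂(poissonMeasure a) = s := by
  rw [integral_poissonMeasure]
  exact h.tsum_eq

theorem cast_descFactorial_eq_eval (n k : ℕ) :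
    (n.descFactorial k : ℝ) = (descPochhammer ℝ k).eval (n : ℝ) :=
  (descPochhammer_eval_eq_descFactorial ℝ n k).symm

theorem integral_poissonMeasure_sq_sub (a : ℝ≥0) (μ c : ℝ) :
    ∫ n : ℕ, (((n : ℝ) - μ) ^ 2 - n - c) ∂(poissonMeasure a) = ((a : ℝ) - μ) ^ 2 - c := by
  have D := hasSum_poisson_mul_descFactorial a
  have h := ((D 2).add ((D 1).mul_left (-2 * μ))).add ((D 0).mul_left (μ ^ 2 - c))
  apply integral_poissonMeasure_eq_of_hasSum
  convert! h using 1
  · ext n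
    simp only [cast_descFactorial_eq_eval, descPochhammer_succ_eval, descPochhammer_zero,
      Polynomial.eval_one]
    push_cast
    ring
  · ring

theorem integral_poissonMeasure_sq_sub_sq (a : ℝ≥0) (μ c : ℝ) :
    ∫ n : ℕ, (((n : ℝ) - μ) ^ 2 - n - c) ^ 2 ∂(poissonMeasure a) =
      2 * (a : ℝ) ^ 2 + 4 * a * (a - μ) ^ 2 + (((a : ℝ) - μ) ^ 2 - c) ^ 2 := by
  have D := hasSum_poisson_mul_descFactorial a
  have h := ((((D 4).add ((D 3).mul_left (4 - 4 * μ))).add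
    ((D 2).mul_left (2 + 4 * μ ^ 2 - 8 * μ + 2 * (μ ^ 2 - c)))).add
    ((D 1).mul_left (4 * μ ^ 2 - 4 * μ * (μ ^ 2 - c)))).add ((D 0).mul_left ((μ ^ 2 - c) ^ 2))
  apply integral_poissonMeasure_eq_of_hasSum
  convert! h using 1
  · ext n
    simp only [cast_descFactorial_eq_eval, descPochhammer_succ_eval, descPochhammer_zero,
      Polynomial.eval_one]
    push_cast
    ring
  · ring

/-- If `M` is a Poisson(`a`) random variable and `μ : ℝ`, then
`Var[(M − μ)² − M] = 2a² + 4a(a − μ)²`; in particular, if `a = μ` then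
`E[((M − μ)² − M)²] = 2μ²`. -/
theorem poisson_centered_variance {Ω : Type*} [MeasurableSpace Ω]
    (P : Measure Ω) [IsProbabilityMeasure P] (a : ℝ≥0) (μ : ℝ)
    (M : Ω → ℕ) (hM : Measurable M)
    (hlaw : Measure.map M P = poissonMeasure a) :
    variance (fun ω => ((M ω : ℝ) - μ) ^ 2 - (M ω : ℝ)) P =
      2 * (a : ℝ) ^ 2 + 4 * (a : ℝ) * ((a : ℝ) - μ) ^ 2 ∧
    ((a : ℝ) = μ →
      ∫ ω, (((M ω : ℝ) - μ) ^ 2 - (M ω : ℝ)) ^ 2 ∂P = 2 * μ ^ 2) := by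
  have hlawInt (f : ℕ → ℝ) : ∫ ω, f (M ω) ∂P = ∫ n, f n ∂(poissonMeasure a) := by
    rw [← hlaw, integral_map hM.aemeasurable .of_discrete]
  have hmean : ∫ ω, (((M ω : ℝ) - μ) ^ 2 - (M ω : ℝ)) ∂P = ((a : ℝ) - μ) ^ 2 := by
    have h := integral_poissonMeasure_sq_sub a μ 0
    rw [← hlawInt] at h
    simpa only [sub_zero] using h
  have hsq (c : ℝ) := (hlawInt fun n => (((n : ℝ) - μ) ^ 2 - n - c) ^ 2).trans
    (integral_poissonMeasure_sq_sub_sq a μ c)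
  refine ⟨?_, ?_⟩
  · have hmeas : Measurable fun ω => ((M ω : ℝ) - μ) ^ 2 - (M ω : ℝ) := by fun_prop
    rw [variance_eq_integral hmeas.aemeasurable, hmean, hsq]
    ring
  · rintro rfl
    have h := hsq 0
    simp only [sub_zero] at h
    rw [h]
    ring
end

section
/- Let p and q be two probability distributions on [k]. Then ‖Φ_ε(p) − Φ_ε(q)‖₂² ≥ (1/(2s))·((e^ε − 1)/(e^ε + K/s − 1))²·‖p − q‖₂², where ‖·‖₂² denotes the sum of squared coordinates of the difference. -/
open Real Finset

/-- The generalised-Hadamard-response privatisation map: given subsets `C x ⊆ [K]` of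
size `s`, it sends a distribution `p` on `[k]` to the distribution on `[K]` with
`Φ_ε(p)(y) = ((e^ε − 1)·∑_x p(x)·1[y ∈ C x] + 1)/(s·e^ε + K − s)`. -/
noncomputable def ghrMap (k K s : ℕ) (ε : ℝ) (C : Fin k → Finset (Fin K))
    (p : Fin k → ℝ) (y : Fin K) : ℝ :=
  ((Real.exp ε - 1) * (∑ x, p x * (if y ∈ C x then 1 else 0)) + 1) /
    (s * Real.exp ε + K - s)

/-- The squared `ℓ²` norm of a combination of indicators is the quadratic form of the
matrix of intersection sizes. -/
theorem sum_sq_sum_mul_indicator {ι κ : Type*} [Fintype ι] [Fintype κ] [DecidableEq κ]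
    (C : ι → Finset κ) (d : ι → ℝ) :
    ∑ y, (∑ x, d x * (if y ∈ C x then 1 else 0)) ^ 2 =
      ∑ x, ∑ x', d x * d x' * ((C x ∩ C x').card : ℝ) := by
  simp_rw [sq, Finset.sum_mul_sum]
  rw [Finset.sum_comm]
  refine Finset.sum_congr rfl fun x _ => ?_
  rw [Finset.sum_comm]
  refine Finset.sum_congr rfl fun x' _ => ?_
  have hcard : ((C x ∩ C x').card : ℝ) =
      ∑ y, (if y ∈ C x then (1 : ℝ) else 0) * (if y ∈ C x' then 1 else 0) := by
    simp [← ite_and, ← Finset.mem_inter, Finset.inter_comm]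
  rw [hcard, Finset.mul_sum]
  exact Finset.sum_congr rfl fun y _ => by ring

/-- The quadratic form of the indicator matrix of an equivalence relation given by the fibres
of a map is nonnegative. -/
theorem sum_sum_mul_fiber_indicator_nonneg {ι α : Type*} [Fintype ι] [Fintype α]
    [DecidableEq α] (g : ι → α) (d : ι → ℝ) :
    0 ≤ ∑ x, ∑ x', d x * d x' * (if g x = g x' then 1 else 0) := by
  have h : ∑ x, ∑ x', d x * d x' * (if g x = g x' then (1 : ℝ) else 0) =
      ∑ j, (∑ x, d x * (if g x = j then 1 else 0)) ^ 2 := by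
    simp_rw [sq, Finset.sum_mul_sum]
    rw [Finset.sum_comm (s := (Finset.univ : Finset α))]
    refine Finset.sum_congr rfl fun x _ => ?_
    rw [Finset.sum_comm]
    refine Finset.sum_congr rfl fun x' _ => ?_
    simp [eq_comm]
  rw [h]
  exact Finset.sum_nonneg fun j _ => sq_nonneg _

/-- If distinct sets of size `s` meet in `s / 2` points within a group and are disjoint across
groups, then the indicators satisfy a lower Riesz bound with constant `s / 2`. -/
theorem half_mul_sum_sq_le_sum_sq_sum_mul_indicator {ι κ α : Type*} [Fintype ι] [DecidableEq ι]
    [Fintype κ] [DecidableEq κ] [Fintype α] [DecidableEq α] {s : ℕ}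
    (C : ι → Finset κ) (hC : ∀ x, (C x).card = s) (g : ι → α)
    (hsame : ∀ x x', x ≠ x' → g x = g x' → 2 * (C x ∩ C x').card = s)
    (hdiff : ∀ x x', g x ≠ g x' → C x ∩ C x' = ∅) (d : ι → ℝ) :
    (s / 2 : ℝ) * ∑ x, d x ^ 2 ≤ ∑ y, (∑ x, d x * (if y ∈ C x then 1 else 0)) ^ 2 := by
  have hcard : ∀ x x', ((C x ∩ C x').card : ℝ) =
      (s / 2 : ℝ) * (if g x = g x' then 1 else 0) + (s / 2 : ℝ) * (if x = x' then 1 else 0) := by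
    intro x x'
    by_cases hx : x = x'
    · subst hx
      simp [hC]
    · by_cases hg : g x = g x'
      · have h : (2 : ℝ) * ((C x ∩ C x').card : ℝ) = s := by exact_mod_cast hsame x x' hx hg
        simp only [hx, hg, if_true, if_false]
        linarith
      · simp [hx, hg, hdiff x x' hg]
  have hsplit : ∑ x, ∑ x', d x * d x' * ((C x ∩ C x').card : ℝ) =
      (s / 2 : ℝ) * ∑ x, ∑ x', d x * d x' * (if g x = g x' then 1 else 0) +
        (s / 2 : ℝ) * ∑ x, d x ^ 2 := by
    rw [Finset.mul_sum, Finset.mul_sum, ← Finset.sum_add_distrib]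
    refine Finset.sum_congr rfl fun x _ => ?_
    have hdiag : d x ^ 2 = ∑ x', d x * d x' * (if x = x' then 1 else 0) := by
      simp [sq]
    rw [hdiag, Finset.mul_sum, Finset.mul_sum, ← Finset.sum_add_distrib]
    refine Finset.sum_congr rfl fun x' _ => ?_
    rw [hcard]
    ring
  rw [sum_sq_sum_mul_indicator, hsplit]
  have := mul_nonneg (by positivity : (0 : ℝ) ≤ s / 2) (sum_sum_mul_fiber_indicator_nonneg g d)
  linarith

/-- Parseval-type lower bound for generalised Hadamard response:
`‖Φ_ε(p) − Φ_ε(q)‖₂² ≥ (1/(2s))·((e^ε − 1)/(e^ε + K/s − 1))²·‖p − q‖₂²`. -/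
theorem ghr_l2_lower_bound (k K s : ℕ) (hk : 0 < k) (hK : 0 < K) (hs : 0 < s)
    (hsK : s ≤ K) (ε : ℝ) (hε : 0 < ε)
    (C : Fin k → Finset (Fin K)) (hC : ∀ x, (C x).card = s)
    (a : ℕ) (g : Fin k → Fin a)
    (hsame : ∀ x x', x ≠ x' → g x = g x' → 2 * (C x ∩ C x').card = s)
    (hdiff : ∀ x x', g x ≠ g x' → C x ∩ C x' = ∅)
    (p q : Fin k → ℝ) (hp0 : ∀ x, 0 ≤ p x) (hp1 : ∑ x, p x = 1)
    (hq0 : ∀ x, 0 ≤ q x) (hq1 : ∑ x, q x = 1) :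
    ∑ y, (ghrMap k K s ε C p y - ghrMap k K s ε C q y) ^ 2 ≥
      (1 / (2 * s)) * ((Real.exp ε - 1) / (Real.exp ε + (K : ℝ) / s - 1)) ^ 2 *
        ∑ x, (p x - q x) ^ 2 := by
  have hs' : (0 : ℝ) < s := by exact_mod_cast hs
  have hsK' : (s : ℝ) ≤ K := by exact_mod_cast hsK
  have hD : 0 < (s : ℝ) * Real.exp ε + K - s := by
    have := mul_pos hs' (Real.exp_pos ε)
    linarith
  have hmap : ∀ y, ghrMap k K s ε C p y - ghrMap k K s ε C q y =
      (Real.exp ε - 1) / (s * Real.exp ε + K - s) *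
        ∑ x, (p x - q x) * (if y ∈ C x then 1 else 0) := by
    intro y
    simp only [ghrMap, sub_mul, Finset.sum_sub_distrib]
    ring
  have hscale : Real.exp ε + (K : ℝ) / s - 1 = (s * Real.exp ε + K - s) / s := by
    field_simp
  simp_rw [hmap, mul_pow]
  rw [← Finset.mul_sum, hscale]
  have hconst : 1 / (2 * (s : ℝ)) *
      ((Real.exp ε - 1) / ((s * Real.exp ε + K - s) / s)) ^ 2 =
      ((Real.exp ε - 1) / (s * Real.exp ε + K - s)) ^ 2 * (s / 2) := by
    field_simp
  rw [hconst, mul_assoc]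
  exact mul_le_mul_of_nonneg_left
    (half_mul_sum_sq_le_sum_sq_sum_mul_indicator C hC g hsame hdiff fun x => p x - q x)
    (sq_nonneg _)
end

section
/- Let L ≥ 1 be an integer, let Y be a finite set, and let q : [2L] × Y → ℝ≥0 satisfy ∑_{y∈Y} q(x,y) = 1 for every x ∈ [2L] and q(x,y) ≤ e^ε·q(x',y) for all x, x' ∈ [2L] and y ∈ Y (the ε-LDP condition). Then ∑_{y∈Y} [∑_{i=1}^{L} (q(2i,y) − q(2i−1,y))²] / [∑_{x∈[2L]} q(x,y)] ≤ 2e^ε, where terms with zero denominator are interpreted as zero. -/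
open Real Finset

/-- A sum over `Fin (2 * L)` split into its even-indexed and odd-indexed terms. -/
theorem sum_eq_sum_even_add_odd {M : Type*} [AddCommMonoid M] {L : ℕ} (f : Fin (2 * L) → M)
    {a b : Fin L → Fin (2 * L)} (ha : ∀ i, (a i : ℕ) = 2 * i) (hb : ∀ i, (b i : ℕ) = 2 * i + 1) :
    ∑ x, f x = ∑ i, (f (a i) + f (b i)) := by
  have inj : Function.Injective (Sum.elim a b) := by
    rintro (i | i) (j | j) h <;> have := congrArg Fin.val h <;>
      simp only [Sum.elim_inl, Sum.elim_inr, ha, hb] at this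
    · exact congrArg Sum.inl (Fin.ext (by omega))
    · omega
    · omega
    · exact congrArg Sum.inr (Fin.ext (by omega))
  have bij : Function.Bijective (Sum.elim a b) :=
    (Fintype.bijective_iff_injective_and_card _).2 ⟨inj, by simp [two_mul]⟩
  rw [← Fintype.sum_bijective _ bij (fun s => f (Sum.elim a b s)) f fun _ => rfl,
    Fintype.sum_sum_type, sum_add_distrib]
  rfl

/-- Trace bound for the information matrix of an `ε`-LDP randomiser: if
`q : [2L] × Y → ℝ≥0` has `∑_y q(x,y) = 1` for each `x` and satisfies the `ε`-LDP
condition `q(x,y) ≤ e^ε q(x',y)`, then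
`∑_y (∑_{i=1}^L (q(2i,y) − q(2i−1,y))²) / (∑_x q(x,y)) ≤ 2 e^ε`. -/
theorem ldp_trace_bound (L : ℕ) (hL : 1 ≤ L) (Y : Type*) [Fintype Y]
    (ε : ℝ) (hε : 0 < ε)
    (q : Fin (2 * L) → Y → ℝ) (hq0 : ∀ x y, 0 ≤ q x y)
    (hq1 : ∀ x, ∑ y, q x y = 1)
    (hldp : ∀ x x' y, q x y ≤ Real.exp ε * q x' y) :
    ∑ y, (∑ i : Fin L,
        (q ⟨2 * (i : ℕ) + 1, by omega⟩ y - q ⟨2 * (i : ℕ), by omega⟩ y) ^ 2) /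
      (∑ x, q x y) ≤ 2 * Real.exp ε := by
  let x₀ : Fin (2 * L) := ⟨0, by omega⟩
  have term_le (y : Y) : (∑ i : Fin L,
        (q ⟨2 * (i : ℕ) + 1, by omega⟩ y - q ⟨2 * (i : ℕ), by omega⟩ y) ^ 2) /
      (∑ x, q x y) ≤ Real.exp ε * q x₀ y := by
    refine div_le_of_le_mul₀ (sum_nonneg fun x _ => hq0 x y)
      (mul_nonneg (exp_pos ε).le (hq0 x₀ y)) ?_
    calc
      _ ≤ ∑ i : Fin L, (q ⟨2 * (i : ℕ), by omega⟩ y ^ 2 +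
          q ⟨2 * (i : ℕ) + 1, by omega⟩ y ^ 2) := by
        refine sum_le_sum fun i _ => ?_
        nlinarith [mul_nonneg (hq0 ⟨2 * (i : ℕ), by omega⟩ y)
          (hq0 ⟨2 * (i : ℕ) + 1, by omega⟩ y)]
      _ = ∑ x, q x y ^ 2 :=
        (sum_eq_sum_even_add_odd (fun x => q x y ^ 2) (fun _ => rfl) fun _ => rfl).symm
      _ ≤ ∑ x, Real.exp ε * q x₀ y * q x y := by
        refine sum_le_sum fun x _ => ?_
        rw [sq]
        exact mul_le_mul_of_nonneg_right (hldp x x₀ y) (hq0 x y)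
      _ = Real.exp ε * q x₀ y * ∑ x, q x y := (mul_sum _ _ _).symm
  calc
    _ ≤ ∑ y, Real.exp ε * q x₀ y := sum_le_sum fun y _ => term_le y
    _ = Real.exp ε := by rw [← mul_sum, hq1, mul_one]
    _ ≤ 2 * Real.exp ε := by linarith [exp_pos ε]
end

section
/- Let L ≥ 1 be an integer, let Y be a finite set, let ε > 0 and δ ∈ [0,1], and let q : [2L] × Y → ℝ≥0 satisfy ∑_{y∈Y} q(x,y) = 1 for every x ∈ [2L] and q(x,y) ≤ e^ε·q(x',y) + δ for all x, x' ∈ [2L] and y ∈ Y. Then ∑_{y∈Y} [∑_{i=1}^{L} (q(2i,y) − q(2i−1,y))²] / [∑_{x∈[2L]} q(x,y)] ≤ 2(e^ε + δ·|Y|), where terms with zero denominator are interpreted as zero. -/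
open Real Finset

/-- A sum over `Fin (2 * L)` splits into consecutive pairs. -/
theorem Fin.sum_two_mul_eq_sum_pairs {M : Type*} [AddCommMonoid M] {L : ℕ}
    (f : Fin (2 * L) → M) (hodd : ∀ i : Fin L, 2 * (i : ℕ) + 1 < 2 * L)
    (heven : ∀ i : Fin L, 2 * (i : ℕ) < 2 * L) :
    ∑ x, f x = ∑ i : Fin L, (f ⟨2 * (i : ℕ) + 1, hodd i⟩ + f ⟨2 * (i : ℕ), heven i⟩) := by
  rw [← (finProdFinEquiv.trans (finCongr (mul_comm L 2))).sum_comp f, Fintype.sum_prod_type]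
  refine Finset.sum_congr rfl fun i _ => ?_
  rw [Fin.sum_univ_two, add_comm]
  congr 2 <;> ext <;> simp [add_comm]

/-- The squared difference of two numbers in `[0, M]` is at most `M` times their sum. -/
theorem sub_sq_le_mul_add {a b M : ℝ} (ha : 0 ≤ a) (hb : 0 ≤ b) (haM : a ≤ M) (hbM : b ≤ M) :
    (a - b) ^ 2 ≤ M * (a + b) := by
  nlinarith [mul_nonneg ha (sub_nonneg.2 haM), mul_nonneg hb (sub_nonneg.2 hbM), mul_nonneg ha hb]

/-- Trace bound for the information matrix of an approximately locally private
randomiser: if `q : [2L] × Y → ℝ≥0` has `∑_y q(x,y) = 1` for each `x` and satisfies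
`q(x,y) ≤ e^ε q(x',y) + δ`, then
`∑_y (∑_{i=1}^L (q(2i,y) − q(2i−1,y))²) / (∑_x q(x,y)) ≤ 2 (e^ε + δ |Y|)`. -/
theorem approx_ldp_trace_bound (L : ℕ) (hL : 1 ≤ L) (Y : Type*) [Fintype Y]
    (ε δ : ℝ) (hε : 0 < ε) (hδ0 : 0 ≤ δ) (hδ1 : δ ≤ 1)
    (q : Fin (2 * L) → Y → ℝ) (hq0 : ∀ x y, 0 ≤ q x y)
    (hq1 : ∀ x, ∑ y, q x y = 1)
    (hldp : ∀ x x' y, q x y ≤ Real.exp ε * q x' y + δ) :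
    ∑ y, (∑ i : Fin L,
        (q ⟨2 * (i : ℕ) + 1, by omega⟩ y - q ⟨2 * (i : ℕ), by omega⟩ y) ^ 2) /
      (∑ x, q x y) ≤ 2 * (Real.exp ε + δ * (Fintype.card Y)) := by
  obtain ⟨x₀⟩ : Nonempty (Fin (2 * L)) := ⟨⟨0, by omega⟩⟩
  have hpoint (y : Y) : (∑ i : Fin L,
        (q ⟨2 * (i : ℕ) + 1, by omega⟩ y - q ⟨2 * (i : ℕ), by omega⟩ y) ^ 2) /
      (∑ x, q x y) ≤ Real.exp ε * q x₀ y + δ := by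
    refine div_le_of_le_mul₀ (Finset.sum_nonneg fun x _ => hq0 x y)
      ((hq0 x₀ y).trans (hldp x₀ x₀ y)) ?_
    rw [Fin.sum_two_mul_eq_sum_pairs (fun x => q x y) (fun i => by omega) (fun i => by omega),
       Finset.mul_sum]
    exact Finset.sum_le_sum fun i _ =>
      sub_sq_le_mul_add (hq0 _ y) (hq0 _ y) (hldp _ x₀ y) (hldp _ x₀ y)
  have hsum : ∑ y, (Real.exp ε * q x₀ y + δ) = Real.exp ε + δ * Fintype.card Y := by
    rw [Finset.sum_add_distrib, ← Finset.mul_sum, hq1]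
    simp [mul_comm]
  have hnonneg : 0 ≤ Real.exp ε + δ * Fintype.card Y := by positivity
  linarith [Finset.sum_le_sum fun y (_ : y ∈ Finset.univ) => hpoint y]
end

section
/- Let k ≥ 1 be an integer, p a probability distribution on [k], n > 0 and λ ≥ 0 real numbers, μ = n/k + λ/2, and set E = n·k·∑_{j=1}^k (p_j − 1/k)². Then ∑_{j=1}^k 4n·(p_j + λ/(2n))·(p_j − 1/k)² ≤ 4·(E^{3/2}/(n^{1/2}·k^{3/2}) + μ·E/(n·k^{1/2})). -/
theorem rpow_three_halves {x : ℝ} (hx : 0 ≤ x) : x ^ ((3 : ℝ) / 2) = x * √x := by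
  rw [show (3 : ℝ) / 2 = 1 + 1 / 2 by norm_num,
    Real.rpow_add_of_nonneg hx (by norm_num) (by norm_num), Real.rpow_one, Real.sqrt_eq_rpow]

/-- Bound on the cross term in the variance computation: with `μ = n/k + λ/2` and
`E = n·k·∑_j (p_j − 1/k)²`, one has
`∑_j 4n (p_j + λ/(2n)) (p_j − 1/k)² ≤ 4 (E^(3/2)/(n^(1/2) k^(3/2)) + μ E/(n k^(1/2)))`. -/
theorem cross_term_bound (k : ℕ) (hk : 1 ≤ k) (p : Fin k → ℝ) (hp : ∀ j, 0 ≤ p j)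
    (hsum : ∑ j, p j = 1) (n lam : ℝ) (hn : 0 < n) (hlam : 0 ≤ lam)
    (μ E : ℝ) (hμ : μ = n / k + lam / 2)
    (hE : E = n * k * ∑ j, (p j - 1 / k) ^ 2) :
    ∑ j, 4 * n * (p j + lam / (2 * n)) * (p j - 1 / k) ^ 2 ≤
      4 * (E ^ ((3 : ℝ) / 2) / (n ^ ((1 : ℝ) / 2) * (k : ℝ) ^ ((3 : ℝ) / 2)) +
        μ * E / (n * (k : ℝ) ^ ((1 : ℝ) / 2))) := by
  have hk1 : (1 : ℝ) ≤ k := by exact_mod_cast hk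
  have hk0 : (0 : ℝ) < k := by linarith
  set S := ∑ j, (p j - 1 / k) ^ 2 with hS
  have hS0 : 0 ≤ S := Finset.sum_nonneg fun j _ => sq_nonneg _
  have hμ0 : 0 ≤ μ := by rw [hμ]; positivity
  have hdev : ∀ j, p j - 1 / k ≤ √S := fun j =>
    Real.le_sqrt_of_sq_le <|
      Finset.single_le_sum (f := fun i => (p i - 1 / (k : ℝ)) ^ 2)
        (fun i _ => sq_nonneg _) (Finset.mem_univ j)
  have hshift : ∀ j, p j + lam / (2 * n) = (p j - 1 / k) + μ / n := fun j => by
    rw [hμ]; field_simp; ring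
  have hleft : ∑ j, 4 * n * (p j + lam / (2 * n)) * (p j - 1 / k) ^ 2 ≤
      4 * n * (√S + μ / n) * S := by
    rw [hS, Finset.mul_sum, ← hS]
    refine Finset.sum_le_sum fun j _ => ?_
    rw [hshift]
    gcongr
    exact hdev j
  have hcube : E ^ ((3 : ℝ) / 2) / (n ^ ((1 : ℝ) / 2) * (k : ℝ) ^ ((3 : ℝ) / 2)) =
      n * √S * S := by
    rw [rpow_three_halves (by rw [hE]; positivity), rpow_three_halves hk0.le,
      ← Real.sqrt_eq_rpow, hE, Real.sqrt_mul (by positivity), Real.sqrt_mul hn.le]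
    have := Real.sqrt_pos.2 hn
    have := Real.sqrt_pos.2 hk0
    field_simp
  have hlin : μ * E / (n * (k : ℝ) ^ ((1 : ℝ) / 2)) = μ * S * √k := by
    rw [← Real.sqrt_eq_rpow, hE]
    have := Real.sqrt_pos.2 hk0
    field_simp
    rw [Real.sq_sqrt hk0.le]
    ring
  have hsqrt : μ * S ≤ μ * S * √k :=
    le_mul_of_one_le_right (by positivity) (Real.one_le_sqrt.2 hk1)
  calc _ ≤ 4 * n * (√S + μ / n) * S := hleft
    _ = 4 * (n * √S * S + μ * S) := by field_simp
    _ ≤ _ := by rw [hcube, hlin]; gcongr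
end
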